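/- Let n ≥ 2 and m ≥ 1 be integers and let A_1, …, A_m be real symmetric n×n matrices with tr(A_α) = 0 for every α. Then Σ_{α,η=1}^m ‖A_α A_η − A_η A_α‖_F² + Σ_{α,η=1}^m (tr(A_α A_η))² ≤ b(m) · ( Σ_{α=1}^m ‖A_α‖_F² )², where b(m) = 1 + (1/2)·sgn(m−1), i.e. b(1) = 1 and b(m) = 3/2 for m ≥ 2. -/

import Mathlib

/-- The sum of squares of the entries of a real matrix is a trace. -/
theorem sum_sq_eq_trace_transpose_mul {k l : Type*} [Fintype k] [Fintype l]
    (X : Matrix k l ℝ) : ∑ i, ∑ j, X i j ^ 2 = (X.transpose * X).trace := by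
  rw [Finset.sum_comm]
  simp [Matrix.trace, Matrix.mul_apply, sq]

/-- The sum of squares of the entries is invariant under orthogonal conjugation. -/
theorem sum_sq_orthogonal_conj {k : Type*} [Fintype k] [DecidableEq k]
    (U X : Matrix k k ℝ) (hU : U * U.transpose = 1) :
    ∑ i, ∑ j, (U.transpose * X * U) i j ^ 2 = ∑ i, ∑ j, X i j ^ 2 := by
  rw [sum_sq_eq_trace_transpose_mul, sum_sq_eq_trace_transpose_mul]
  calc ((U.transpose * X * U).transpose * (U.transpose * X * U)).trace
      = (U.transpose * (X.transpose * (U * U.transpose) * X * U)).trace := by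
        simp only [Matrix.transpose_mul, Matrix.transpose_transpose, Matrix.mul_assoc]
    _ = (X.transpose * X * (U * U.transpose)).trace := by
        rw [Matrix.trace_mul_comm, hU, Matrix.mul_one, Matrix.mul_assoc, hU]
    _ = (X.transpose * X).trace := by rw [hU, Matrix.mul_one]

/-- Orthogonal diagonalization of a real symmetric matrix. -/
theorem exists_orthogonal_conj_eq_diagonal {k : Type*} [Fintype k] [DecidableEq k]
    (X : Matrix k k ℝ) (hX : X.IsSymm) :
    ∃ (U : Matrix k k ℝ) (d : k → ℝ), U * U.transpose = 1 ∧
      U.transpose * X * U = Matrix.diagonal d := by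
  have hH : X.IsHermitian := by
    rw [Matrix.IsHermitian, Matrix.conjTranspose_eq_transpose_of_trivial]
    exact hX
  refine ⟨hH.eigenvectorUnitary, hH.eigenvalues, ?_, ?_⟩
  · have h := Unitary.coe_mul_star_self hH.eigenvectorUnitary
    rwa [Unitary.coe_star, Matrix.star_eq_conjTranspose,
      Matrix.conjTranspose_eq_transpose_of_trivial] at h
  · have h := hH.conjStarAlgAut_star_eigenvectorUnitary
    rw [Unitary.conjStarAlgAut_star_apply, Matrix.star_eq_conjTranspose,
      Matrix.conjTranspose_eq_transpose_of_trivial] at h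
    simpa [Function.comp_def] using h

/-- A star bound: the star Laplacian with `#J` leaves has largest eigenvalue `#J + 1`. -/
theorem sum_sq_sub_le_card_add_one_mul {k : Type*} (l : k → ℝ) (x : ℝ) (J : Finset k) :
    ∑ j ∈ J, (x - l j) ^ 2 ≤ (J.card + 1) * (x ^ 2 + ∑ j ∈ J, l j ^ 2) := by
  have h1 : ∑ j ∈ J, (x - l j) ^ 2 =
      J.card * x ^ 2 - 2 * x * ∑ j ∈ J, l j + ∑ j ∈ J, l j ^ 2 := by
    simp only [sub_sq, Finset.sum_add_distrib, Finset.sum_sub_distrib, Finset.sum_const,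
      nsmul_eq_mul, Finset.mul_sum]
  have h2 := sq_sum_le_card_mul_sum_sq (s := J) (f := l)
  rw [h1]
  nlinarith [sq_nonneg (x + ∑ j ∈ J, l j)]

/-- The pairs whose squared difference exceeds the total sum of squares all share an index. -/
theorem exists_center_of_sum_sq_lt {k : Type*} [Fintype k] [DecidableEq k] [Nonempty k]
    (l : k → ℝ) :
    ∃ c, ∀ i j, ∑ a, l a ^ 2 < (l i - l j) ^ 2 → i = c ∨ j = c := by
  have hsub : ∀ T : Finset k, ∑ a ∈ T, l a ^ 2 ≤ ∑ a, l a ^ 2 := fun T =>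
    Finset.sum_le_sum_of_subset_of_nonneg (Finset.subset_univ T) fun _ _ _ => sq_nonneg _
  have hne : ∀ i j, ∑ a, l a ^ 2 < (l i - l j) ^ 2 → i ≠ j := by
    rintro i j h rfl
    have := hsub ∅
    simp at this h
    linarith
  have hdisj : ∀ i j p q, ∑ a, l a ^ 2 < (l i - l j) ^ 2 → ∑ a, l a ^ 2 < (l p - l q) ^ 2 →
      p = i ∨ p = j ∨ q = i ∨ q = j := by
    intro i j p q h1 h2
    by_contra! hc
    obtain ⟨hpi, hpj, hqi, hqj⟩ := hc
    have h := hsub {i, j, p, q}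
    rw [Finset.sum_insert (by simp [hne i j h1, hpi.symm, hqi.symm]),
      Finset.sum_insert (by simp [hpj.symm, hqj.symm]),
      Finset.sum_pair (hne p q h2)] at h
    nlinarith [sq_nonneg (l i + l j), sq_nonneg (l p + l q)]
  have htri : ∀ i j p, ∑ a, l a ^ 2 < (l i - l j) ^ 2 → ∑ a, l a ^ 2 < (l i - l p) ^ 2 →
      ∑ a, l a ^ 2 < (l j - l p) ^ 2 → False := by
    intro i j p h1 h2 h3
    have h := hsub {i, j, p}
    rw [Finset.sum_insert (by simp [hne i j h1, hne i p h2]),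
      Finset.sum_pair (hne j p h3)] at h
    nlinarith [sq_nonneg (l i + l j + l p)]
  have hcomm : ∀ i j, (l i - l j) ^ 2 = (l j - l i) ^ 2 := fun i j => by ring
  by_contra! hc
  obtain ⟨i, j, hij, -, -⟩ := hc (Classical.arbitrary k)
  obtain ⟨p, q, hpq, hpi, hqi⟩ := hc i
  obtain ⟨r, s, hrs, hrj, hsj⟩ := hc j
  have key : ∀ u v, ∑ a, l a ^ 2 < (l j - l u) ^ 2 → ∑ a, l a ^ 2 < (l i - l v) ^ 2 →
      u ≠ i → v ≠ j → False := by
    intro u v hu hv hui hvj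
    have huv : u = v := by
      rcases hdisj j u i v hu hv with h | h | h | h
      · exact (hne i j hij h).elim
      · exact (hui h.symm).elim
      · exact (hvj h).elim
      · exact h.symm
    subst huv
    exact htri i j u hij hv hu
  obtain ⟨u, hu, hui⟩ : ∃ u, ∑ a, l a ^ 2 < (l j - l u) ^ 2 ∧ u ≠ i := by
    rcases hdisj i j p q hij hpq with h | h | h | h
    · exact (hpi h).elim
    · exact ⟨q, h ▸ hpq, hqi⟩
    · exact (hqi h).elim
    · exact ⟨p, by rw [hcomm, ← h]; exact hpq, hpi⟩
  obtain ⟨v, hv, hvj⟩ : ∃ v, ∑ a, l a ^ 2 < (l i - l v) ^ 2 ∧ v ≠ j := by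
    rcases hdisj i j r s hij hrs with h | h | h | h
    · exact ⟨s, h ▸ hrs, hsj⟩
    · exact (hrj h).elim
    · exact ⟨r, by rw [hcomm, ← h]; exact hrs, hrj⟩
    · exact (hsj h).elim
  exact key u v hu hv hui hvj

/-- The total excess of the squared differences over the sum of squares. -/
theorem sum_max_sq_sub_le {k : Type*} [Fintype k] [DecidableEq k] (l : k → ℝ) :
    ∑ i, ∑ j, max ((l i - l j) ^ 2 - ∑ a, l a ^ 2) 0 ≤ 2 * ∑ a, l a ^ 2 := by
  rcases isEmpty_or_nonempty k with hk | hk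
  · simp
  obtain ⟨c, hc⟩ := exists_center_of_sum_sq_lt l
  set L := ∑ a, l a ^ 2 with hL
  have hL0 : 0 ≤ L := Finset.sum_nonneg fun _ _ => sq_nonneg _
  have hrow : ∑ j, max ((l c - l j) ^ 2 - L) 0 ≤ L := by
    set J := Finset.univ.filter fun j => L < (l c - l j) ^ 2 with hJ
    have h1 : ∑ j, max ((l c - l j) ^ 2 - L) 0 = ∑ j ∈ J, ((l c - l j) ^ 2 - L) := by
      rw [hJ, Finset.sum_filter]
      refine Finset.sum_congr rfl fun j _ => ?_
      split_ifs with h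
      · exact max_eq_left (by linarith)
      · exact max_eq_right (by linarith)
    have hcJ : c ∉ J := by simp [hJ, hL0]
    have h2 : l c ^ 2 + ∑ j ∈ J, l j ^ 2 ≤ L := by
      rw [← Finset.sum_insert (f := fun j => l j ^ 2) hcJ]
      exact Finset.sum_le_sum_of_subset_of_nonneg (Finset.subset_univ _)
        fun _ _ _ => sq_nonneg _
    have h3 := sum_sq_sub_le_card_add_one_mul l (l c) J
    have h4 : ((J.card : ℝ) + 1) * (l c ^ 2 + ∑ j ∈ J, l j ^ 2) ≤ (J.card + 1) * L := by
      gcongr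
    rw [h1, Finset.sum_sub_distrib, Finset.sum_const, nsmul_eq_mul]
    linarith
  have hpt : ∀ i j, max ((l i - l j) ^ 2 - L) 0 ≤
      (if i = c then max ((l c - l j) ^ 2 - L) 0 else 0) +
        (if j = c then max ((l c - l i) ^ 2 - L) 0 else 0) := by
    intro i j
    have hnn : ∀ x : ℝ, 0 ≤ max x 0 := fun x => le_max_right _ _
    by_cases hi : i = c
    · subst hi
      rw [if_pos rfl]
      refine le_add_of_nonneg_right ?_
      split_ifs
      exacts [hnn _, le_rfl]
    · by_cases hj : j = c
      · subst hj
        rw [if_neg hi, if_pos rfl, zero_add, ← neg_sub (l j), neg_sq]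
      · have h : (l i - l j) ^ 2 ≤ L := by
          by_contra! h
          exact (hc i j h).elim hi hj
        rw [if_neg hi, if_neg hj, max_eq_right (by linarith), zero_add]
  calc ∑ i, ∑ j, max ((l i - l j) ^ 2 - L) 0
      ≤ ∑ i, ∑ j, ((if i = c then max ((l c - l j) ^ 2 - L) 0 else 0) +
        (if j = c then max ((l c - l i) ^ 2 - L) 0 else 0)) :=
        Finset.sum_le_sum fun i _ => Finset.sum_le_sum fun j _ => hpt i j
    _ = 2 * ∑ j, max ((l c - l j) ^ 2 - L) 0 := by
        simp only [Finset.sum_add_distrib]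
        rw [Finset.sum_comm]
        simp [two_mul]
    _ ≤ 2 * L := by linarith

/-- Bessel's inequality for an off-diagonal entry of pairwise orthogonal symmetric matrices. -/
theorem two_mul_sum_sq_apply_le {ι k : Type*} [DecidableEq ι] [Fintype k] [DecidableEq k]
    (s : Finset ι) (B : ι → Matrix k k ℝ) (hB : ∀ β, (B β).IsSymm)
    (horth : ∀ β γ, β ≠ γ → (B β * B γ).trace = 0) (M : ℝ) (hM0 : 0 ≤ M)
    (hM : ∀ β ∈ s, (B β * B β).trace ≤ M) {i j : k} (hij : i ≠ j) :
    2 * ∑ β ∈ s, B β i j ^ 2 ≤ M := by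
  set q := ∑ β ∈ s, B β i j ^ 2 with hq
  have hq0 : 0 ≤ q := Finset.sum_nonneg fun _ _ => sq_nonneg _
  set W : Matrix k k ℝ := ∑ β ∈ s, B β i j • B β with hW
  have hWsymm : W.transpose = W := by
    rw [hW, Matrix.transpose_sum]
    exact Finset.sum_congr rfl fun β _ => by rw [Matrix.transpose_smul, (hB β).eq]
  have hWij : W i j = q := by
    simp [hW, hq, Matrix.sum_apply, sq]
  have hWji : W j i = q := by rw [← hWij, ← Matrix.transpose_apply W, hWsymm]
  have hnorm : ∑ a, ∑ b, W a b ^ 2 ≤ M * q := by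
    rw [sum_sq_eq_trace_transpose_mul, hWsymm, hW, Finset.sum_mul_sum, Matrix.trace_sum, hq,
      Finset.mul_sum]
    refine Finset.sum_le_sum fun β hβ => ?_
    rw [Matrix.trace_sum, Finset.sum_eq_single_of_mem β hβ]
    · rw [Matrix.smul_mul, Matrix.mul_smul, Matrix.trace_smul, Matrix.trace_smul, smul_eq_mul,
        smul_eq_mul]
      nlinarith [hM β hβ, sq_nonneg (B β i j)]
    · intro γ _ hγ
      rw [Matrix.smul_mul, Matrix.mul_smul, Matrix.trace_smul, Matrix.trace_smul,
        horth β γ hγ.symm]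
      simp
  have hlow : 2 * q ^ 2 ≤ ∑ a, ∑ b, W a b ^ 2 := by
    have h1 : ∑ a ∈ ({i, j} : Finset k), ∑ b, W a b ^ 2 ≤ ∑ a, ∑ b, W a b ^ 2 :=
      Finset.sum_le_sum_of_subset_of_nonneg (Finset.subset_univ _)
        fun _ _ _ => Finset.sum_nonneg fun _ _ => sq_nonneg _
    rw [Finset.sum_pair hij] at h1
    have h2 : W i j ^ 2 ≤ ∑ b, W i b ^ 2 :=
      Finset.single_le_sum (f := fun b => W i b ^ 2) (fun _ _ => sq_nonneg _)
        (Finset.mem_univ j)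
    have h3 : W j i ^ 2 ≤ ∑ b, W j b ^ 2 :=
      Finset.single_le_sum (f := fun b => W j b ^ 2) (fun _ _ => sq_nonneg _)
        (Finset.mem_univ i)
    rw [hWij] at h2
    rw [hWji] at h3
    linarith
  rcases hq0.eq_or_lt with h | h
  · linarith
  · by_contra! hc
    nlinarith

/-- Moving the outer sum of a triple sum to the innermost place. -/
theorem sum_sum_sum_rotate {ι k : Type*} [Fintype k] (s : Finset ι) (f : ι → k → k → ℝ) :
    ∑ β ∈ s, ∑ i, ∑ j, f β i j = ∑ i, ∑ j, ∑ β ∈ s, f β i j := by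
  rw [Finset.sum_comm]
  exact Finset.sum_congr rfl fun i _ => Finset.sum_comm

/-- The commutator bound when the first matrix is diagonal. -/
theorem sum_commutator_diagonal_le {ι k : Type*} [DecidableEq ι] [Fintype k] [DecidableEq k]
    (s : Finset ι) (l : k → ℝ) (B : ι → Matrix k k ℝ) (hB : ∀ β, (B β).IsSymm)
    (horth : ∀ β γ, β ≠ γ → (B β * B γ).trace = 0) (M : ℝ) (hM0 : 0 ≤ M)
    (hM : ∀ β ∈ s, (B β * B β).trace ≤ M) :
    ∑ β ∈ s, ∑ i, ∑ j, (Matrix.diagonal l * B β - B β * Matrix.diagonal l) i j ^ 2 ≤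
      (∑ a, l a ^ 2) * (∑ β ∈ s, ∑ i, ∑ j, B β i j ^ 2 + M) := by
  set L := ∑ a, l a ^ 2 with hL
  have hpt : ∀ i j, ∑ β ∈ s, (Matrix.diagonal l * B β - B β * Matrix.diagonal l) i j ^ 2 ≤
      L * ∑ β ∈ s, B β i j ^ 2 + M / 2 * max ((l i - l j) ^ 2 - L) 0 := by
    intro i j
    have h1 : ∑ β ∈ s, (Matrix.diagonal l * B β - B β * Matrix.diagonal l) i j ^ 2 =
        (l i - l j) ^ 2 * ∑ β ∈ s, B β i j ^ 2 := by
      rw [Finset.mul_sum]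
      refine Finset.sum_congr rfl fun β _ => ?_
      rw [Matrix.sub_apply, Matrix.diagonal_mul, Matrix.mul_diagonal]
      ring
    have hr0 : 0 ≤ ∑ β ∈ s, B β i j ^ 2 := Finset.sum_nonneg fun _ _ => sq_nonneg _
    have hL0 : 0 ≤ L := Finset.sum_nonneg fun _ _ => sq_nonneg _
    rw [h1]
    by_cases hij : i = j
    · subst hij
      have h3 : 0 ≤ M / 2 * max ((l i - l i) ^ 2 - L) 0 := by positivity
      have h4 : 0 ≤ L * ∑ β ∈ s, B β i i ^ 2 := by positivity
      rw [sub_self] at h3 ⊢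
      linarith
    · have h2 := two_mul_sum_sq_apply_le s B hB horth M hM0 hM hij
      have h3 : ((l i - l j) ^ 2 - L) * ∑ β ∈ s, B β i j ^ 2 ≤
          max ((l i - l j) ^ 2 - L) 0 * (M / 2) :=
        mul_le_mul (le_max_left _ _) (by linarith) hr0 (le_max_right _ _)
      linarith
  rw [sum_sum_sum_rotate, sum_sum_sum_rotate]
  calc _ ≤ ∑ i, ∑ j, (L * ∑ β ∈ s, B β i j ^ 2 + M / 2 * max ((l i - l j) ^ 2 - L) 0) :=
        Finset.sum_le_sum fun i _ => Finset.sum_le_sum fun j _ => hpt i j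
    _ = L * ∑ i, ∑ j, ∑ β ∈ s, B β i j ^ 2 +
        M / 2 * ∑ i, ∑ j, max ((l i - l j) ^ 2 - L) 0 := by
        simp only [Finset.sum_add_distrib, ← Finset.mul_sum]
    _ ≤ _ := by
        have := mul_le_mul_of_nonneg_left (sum_max_sq_sub_le l) (div_nonneg hM0 zero_le_two)
        linarith

/-- Lu's commutator bound for a symmetric matrix against pairwise orthogonal ones. -/
theorem sum_commutator_le {ι k : Type*} [DecidableEq ι] [Fintype k] [DecidableEq k]
    (s : Finset ι) (A : Matrix k k ℝ) (hA : A.IsSymm)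
    (B : ι → Matrix k k ℝ) (hB : ∀ β, (B β).IsSymm)
    (horth : ∀ β γ, β ≠ γ → (B β * B γ).trace = 0) (M : ℝ) (hM0 : 0 ≤ M)
    (hM : ∀ β ∈ s, (B β * B β).trace ≤ M) :
    ∑ β ∈ s, ∑ i, ∑ j, (A * B β - B β * A) i j ^ 2 ≤
      (∑ i, ∑ j, A i j ^ 2) * (∑ β ∈ s, ∑ i, ∑ j, B β i j ^ 2 + M) := by
  obtain ⟨U, l, hU, hd⟩ := exists_orthogonal_conj_eq_diagonal A hA
  have hmul : ∀ X Y : Matrix k k ℝ, (U.transpose * X * U) * (U.transpose * Y * U) =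
      U.transpose * (X * Y) * U := fun X Y => by
    calc _ = U.transpose * X * (U * U.transpose) * Y * U := by
          simp only [Matrix.mul_assoc]
      _ = _ := by rw [hU, Matrix.mul_one, Matrix.mul_assoc U.transpose X Y]
  have htr : ∀ X : Matrix k k ℝ, (U.transpose * X * U).trace = X.trace := fun X => by
    rw [Matrix.trace_mul_comm, ← Matrix.mul_assoc, hU, Matrix.one_mul]
  have h := sum_commutator_diagonal_le s l (fun β => U.transpose * B β * U)
    (fun β => by
      rw [Matrix.IsSymm, Matrix.transpose_mul, Matrix.transpose_mul,
        Matrix.transpose_transpose, (hB β).eq, Matrix.mul_assoc])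
    (fun β γ hβγ => by rw [hmul, htr, horth β γ hβγ]) M hM0
    (fun β hβ => by rw [hmul, htr]; exact hM β hβ)
  have hA2 : ∑ i, ∑ j, A i j ^ 2 = ∑ a, l a ^ 2 := by
    rw [← sum_sq_orthogonal_conj U A hU, hd]
    simp [Matrix.diagonal_apply, ite_pow]
  rw [hA2]
  simp only [← hd, hmul, ← Matrix.mul_sub, ← Matrix.sub_mul, sum_sq_orthogonal_conj U _ hU] at h
  exact h

/-- The commutator estimate over a finite family of pairwise orthogonal symmetric matrices. -/
theorem exists_sum_commutator_le {ι k : Type*} [DecidableEq ι] [Fintype k] [DecidableEq k]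
    (B : ι → Matrix k k ℝ) (hB : ∀ β, (B β).IsSymm)
    (horth : ∀ β γ, β ≠ γ → (B β * B γ).trace = 0) (s : Finset ι) :
    ∃ b, 0 ≤ b ∧ (∀ x ∈ s, (B x * B x).trace ≤ b) ∧
      (∀ c, 0 ≤ c → (∀ x ∈ s, (B x * B x).trace ≤ c) → b ≤ c) ∧
      b ≤ ∑ x ∈ s, (B x * B x).trace ∧
      ∑ α ∈ s, ∑ β ∈ s, ∑ i, ∑ j, (B α * B β - B β * B α) i j ^ 2 +
        ∑ x ∈ s, (B x * B x).trace ^ 2 ≤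
      (∑ x ∈ s, (B x * B x).trace) ^ 2 + 2 * b * (∑ x ∈ s, (B x * B x).trace - b) := by
  have hS : ∀ x, ∑ i, ∑ j, B x i j ^ 2 = (B x * B x).trace := fun x => by
    rw [sum_sq_eq_trace_transpose_mul, (hB x).eq]
  have hS0 : ∀ x, 0 ≤ (B x * B x).trace := fun x => by
    rw [← hS]
    exact Finset.sum_nonneg fun _ _ => Finset.sum_nonneg fun _ _ => sq_nonneg _
  induction s using Finset.induction_on_max_value (fun x => (B x * B x).trace) with
  | empty => exact ⟨0, by simp⟩
  | insert a s has hmax ih =>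
    obtain ⟨b, hb0, hbs, hbl, hbsum, hb⟩ := ih
    have hba := hbl _ (hS0 a) hmax
    have hsum0 : 0 ≤ ∑ x ∈ s, (B x * B x).trace := Finset.sum_nonneg fun x _ => hS0 x
    have hcomm := sum_commutator_le s (B a) (hB a) B hB horth b hb0 hbs
    simp only [hS] at hcomm
    have hflip : ∑ β ∈ s, ∑ i, ∑ j, (B β * B a - B a * B β) i j ^ 2 =
        ∑ β ∈ s, ∑ i, ∑ j, (B a * B β - B β * B a) i j ^ 2 := by
      refine Finset.sum_congr rfl fun β _ => Finset.sum_congr rfl fun i _ =>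
        Finset.sum_congr rfl fun j _ => ?_
      rw [Matrix.sub_apply, Matrix.sub_apply]
      ring
    refine ⟨(B a * B a).trace, hS0 a, ?_, fun c _ hc => hc a (Finset.mem_insert_self a s),
      ?_, ?_⟩
    · intro x hx
      rcases Finset.mem_insert.1 hx with rfl | hx
      exacts [le_rfl, hmax x hx]
    · rw [Finset.sum_insert has]
      linarith
    · simp only [Finset.sum_insert has, Finset.sum_add_distrib]
      rw [hflip]
      simp only [sub_self, Matrix.zero_apply]
      simp only [ne_eq, OfNat.ofNat_ne_zero, not_false_eq_true, zero_pow, Finset.sum_const_zero]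
      nlinarith [mul_nonneg (sub_nonneg.2 hba) (sub_nonneg.2 hbsum)]

/-- Li–Li inequality: for real symmetric trace-free `n × n` matrices
`A₁, …, A_m`,
`∑_{α,η} ‖[A_α, A_η]‖_F² + ∑_{α,η} (tr (A_α A_η))² ≤ b(m) (∑_α ‖A_α‖_F²)²`,
where `b(1) = 1` and `b(m) = 3/2` for `m ≥ 2`. -/
theorem stmt_5 (n m : ℕ) (hn : 2 ≤ n) (hm : 1 ≤ m)
    (A : Fin m → Matrix (Fin n) (Fin n) ℝ)
    (hsymm : ∀ α, (A α).IsSymm) (htr : ∀ α, (A α).trace = 0) :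
    (∑ α, ∑ η, ∑ i, ∑ j, ((A α * A η - A η * A α) i j) ^ 2) +
        (∑ α, ∑ η, ((A α * A η).trace) ^ 2) ≤
      (if m = 1 then (1 : ℝ) else 3 / 2) *
        (∑ α, ∑ i, ∑ j, ((A α) i j) ^ 2) ^ 2 := by
  have hS : ∀ x, ∑ i, ∑ j, A x i j ^ 2 = (A x * A x).trace := fun x => by
    rw [sum_sq_eq_trace_transpose_mul, (hsymm x).eq]
  simp only [hS]
  split_ifs with h1
  · subst h1
    simp
  set G : Matrix (Fin m) (Fin m) ℝ := Matrix.of fun α β => (A α * A β).trace with hG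
  obtain ⟨U, d, hU, hd⟩ := exists_orthogonal_conj_eq_diagonal G
    (Matrix.IsSymm.ext fun α β => Matrix.trace_mul_comm (A β) (A α))
  set B : Fin m → Matrix (Fin n) (Fin n) ℝ := fun α => ∑ β, U β α • A β with hB
  have hBmul : ∀ α β, B α * B β = ∑ γ, ∑ δ, (U γ α * U δ β) • (A γ * A δ) := fun α β => by
    simp only [hB, Finset.sum_mul_sum, Matrix.smul_mul, Matrix.mul_smul, smul_smul, mul_comm]
  have hconj : ∀ (X : Matrix (Fin m) (Fin m) ℝ) (α β),
      (U.transpose * X * U) α β = ∑ γ, ∑ δ, U γ α * U δ β * X γ δ := fun X α β => by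
    simp only [Matrix.mul_apply, Matrix.transpose_apply, Finset.sum_mul]
    rw [Finset.sum_comm]
    exact Finset.sum_congr rfl fun γ _ => Finset.sum_congr rfl fun δ _ => by ring
  have hBtr : ∀ α β, (B α * B β).trace = Matrix.diagonal d α β := fun α β => by
    rw [← hd, hconj, hBmul]
    simp [Matrix.trace_sum, Matrix.trace_smul, hG]
  have hBcomm : ∀ α β i j, (B α * B β - B β * B α) i j =
      (U.transpose * (Matrix.of fun γ δ => (A γ * A δ - A δ * A γ) i j) * U) α β := by
    intro α β i j
    rw [hconj, hBmul, hBmul β α, Finset.sum_comm (γ := Fin m), ← Finset.sum_sub_distrib]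
    simp only [← Finset.sum_sub_distrib, Matrix.sum_apply, Matrix.of_apply]
    rw [Finset.sum_comm]
    refine Finset.sum_congr rfl fun γ _ => Finset.sum_congr rfl fun δ _ => ?_
    simp only [Matrix.sub_apply, Matrix.smul_apply, smul_eq_mul]
    ring
  have hBsymm : ∀ α, (B α).IsSymm := fun α => by
    rw [Matrix.IsSymm, hB, Matrix.transpose_sum]
    exact Finset.sum_congr rfl fun β _ => by rw [Matrix.transpose_smul, (hsymm β).eq]
  obtain ⟨b, -, -, -, -, hb⟩ := exists_sum_commutator_le B hBsymm
    (fun β γ h => by rw [hBtr, Matrix.diagonal_apply_ne _ h]) Finset.univ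
  have hswap : ∀ f : Fin m → Fin m → Fin n → Fin n → ℝ,
      ∑ α, ∑ η, ∑ i, ∑ j, f α η i j = ∑ i, ∑ j, ∑ α, ∑ η, f α η i j := fun f =>
    (Finset.sum_congr rfl fun α _ => sum_sum_sum_rotate _ (f α)).trans (sum_sum_sum_rotate _ _)
  have e1 : ∑ α, ∑ η, ∑ i, ∑ j, (B α * B η - B η * B α) i j ^ 2 =
      ∑ α, ∑ η, ∑ i, ∑ j, (A α * A η - A η * A α) i j ^ 2 := by
    rw [hswap, hswap]
    refine Finset.sum_congr rfl fun i _ => Finset.sum_congr rfl fun j _ => ?_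
    simp only [hBcomm]
    exact sum_sq_orthogonal_conj U _ hU
  have e2 : ∑ x, (B x * B x).trace ^ 2 = ∑ α, ∑ η, (A α * A η).trace ^ 2 := by
    have h := sum_sq_orthogonal_conj U G hU
    rw [hd] at h
    simp only [hBtr]
    simpa [Matrix.diagonal_apply, ite_pow, hG] using h
  have e3 : ∑ x, (B x * B x).trace = ∑ x, (A x * A x).trace := by
    calc ∑ x, (B x * B x).trace = (U.transpose * G * U).trace := by
          rw [hd]
          exact Finset.sum_congr rfl fun x _ => hBtr x x
      _ = G.trace := by
          rw [Matrix.trace_mul_comm, ← Matrix.mul_assoc, hU, Matrix.one_mul]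
      _ = ∑ x, (A x * A x).trace := rfl
  rw [e1, e2, e3] at hb
  nlinarith [sq_nonneg (∑ x, (A x * A x).trace - 2 * b)]
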